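/- Fix q ∈ ℂ with q ≠ 0 and q not a root of unity. Let 𝒰 be the quotient of the free ℂ-algebra on four generators e, f, k, k' by the two-sided ideal generated by kk' − 1, k'k − 1, kek' − qe, kfk' − q⁻¹f, and ef + fe − (k − k')/(q − q⁻¹). Then the images of the monomials e^r f^s k^m, where r, s ∈ ℕ and m ∈ ℤ (with k^m denoting (k')^{−m} when m < 0), form a ℂ-vector-space basis of 𝒰. -/

import Mathlib

noncomputable section

/-- Generators of the free algebra on `e, f, k, k'` (indexed `0, 1, 2, 3`). -/
def Ugen (i : Fin 4) : FreeAlgebra ℂ (Fin 4) := FreeAlgebra.ι ℂ i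

/-- The defining relations (2.1) of `U_q(osp(1,2))`: each constructor `u ~ v`
corresponds to the generator `u − v` of the two-sided ideal. -/
inductive URel (q : ℂ) : FreeAlgebra ℂ (Fin 4) → FreeAlgebra ℂ (Fin 4) → Prop
  | kk' : URel q (Ugen 2 * Ugen 3) 1
  | k'k : URel q (Ugen 3 * Ugen 2) 1
  | kek' : URel q (Ugen 2 * Ugen 0 * Ugen 3) (q • Ugen 0)
  | kfk' : URel q (Ugen 2 * Ugen 1 * Ugen 3) (q⁻¹ • Ugen 1)
  | ef : URel q (Ugen 0 * Ugen 1 + Ugen 1 * Ugen 0) ((q - q⁻¹)⁻¹ • (Ugen 2 - Ugen 3))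

/-- The quantized enveloping algebra `𝒰 = U_q(osp(1,2))`, the quotient of the
free algebra by the two-sided ideal generated by the relations. -/
abbrev QuantumU (q : ℂ) := RingQuot (URel q)

/-- Images of the generators `e, f, k, k'` in `𝒰`. -/
def ugen (q : ℂ) (i : Fin 4) : QuantumU q :=
  RingQuot.mkAlgHom ℂ (URel q) (Ugen i)

/-- `k^m` for `m : ℤ`, meaning `(k')^{−m}` when `m < 0`. -/
def kpow (q : ℂ) (m : ℤ) : QuantumU q :=
  if 0 ≤ m then ugen q 2 ^ m.toNat else ugen q 3 ^ (-m).toNat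

/-- The monomial `e^r f^s k^m` in `𝒰`. -/
def Umono (q : ℂ) (p : ℕ × ℕ × ℤ) : QuantumU q :=
  ugen q 0 ^ p.1 * ugen q 1 ^ p.2.1 * kpow q p.2.2

lemma u_kk (q : ℂ) : ugen q 2 * ugen q 3 = 1 := by
  have := RingQuot.mkAlgHom_rel ℂ (URel.kk' (q := q))
  simpa [ugen] using this

lemma u_kk2 (q : ℂ) : ugen q 3 * ugen q 2 = 1 := by
  have := RingQuot.mkAlgHom_rel ℂ (URel.k'k (q := q))
  simpa [ugen] using this

lemma u_kek (q : ℂ) : ugen q 2 * ugen q 0 * ugen q 3 = q • ugen q 0 := by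
  have := RingQuot.mkAlgHom_rel ℂ (URel.kek' (q := q))
  simpa only [ugen, map_mul, map_smul] using this

lemma u_kfk (q : ℂ) : ugen q 2 * ugen q 1 * ugen q 3 = q⁻¹ • ugen q 1 := by
  have := RingQuot.mkAlgHom_rel ℂ (URel.kfk' (q := q))
  simpa only [ugen, map_mul, map_smul] using this

lemma u_ef (q : ℂ) : ugen q 0 * ugen q 1 + ugen q 1 * ugen q 0
    = (q - q⁻¹)⁻¹ • (ugen q 2 - ugen q 3) := by
  have := RingQuot.mkAlgHom_rel ℂ (URel.ef (q := q))
  simpa only [ugen, map_mul, map_smul, map_add, map_sub] using this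

/-- `k` as a unit. -/
def kU (q : ℂ) : (QuantumU q)ˣ := ⟨ugen q 2, ugen q 3, u_kk q, u_kk2 q⟩

lemma kpow_eq (q : ℂ) (m : ℤ) : kpow q m = ((kU q ^ m : (QuantumU q)ˣ) : QuantumU q) := by
  unfold kpow
  split_ifs with h
  · obtain ⟨n, rfl⟩ := Int.eq_ofNat_of_zero_le h
    simp [kU]
  · obtain ⟨n, hn⟩ := Int.eq_ofNat_of_zero_le (a := -m) (by omega)
    obtain rfl : m = -(n : ℤ) := by omega
    rw [zpow_neg, zpow_natCast, ← inv_pow]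
    simp [kU]

lemma k_kpow (q : ℂ) (m : ℤ) : ugen q 2 * kpow q m = kpow q (m + 1) := by
  rw [kpow_eq, kpow_eq, add_comm, zpow_add, zpow_one]; rfl

lemma k'_kpow (q : ℂ) (m : ℤ) : ugen q 3 * kpow q m = kpow q (m - 1) := by
  rw [kpow_eq, kpow_eq, sub_eq_add_neg, add_comm, zpow_add, zpow_neg_one]; rfl

/-- commutation from conjugation. -/
lemma conj_comm {A : Type*} [Ring A] [Algebra ℂ A] {k k' x : A} {c : ℂ} (hc : c ≠ 0)
    (h1 : k * k' = 1) (h2 : k' * k = 1) (h : k * x * k' = c • x) :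
    k * x = c • (x * k) ∧ k' * x = c⁻¹ • (x * k') := by
  have e1 : k * x = c • (x * k) := by
    rw [← smul_mul_assoc, ← h, mul_assoc _ k' k, h2, mul_one]
  refine ⟨e1, ?_⟩
  have : x * k' = c • (k' * x) := by
    rw [← mul_smul_comm, ← h, ← mul_assoc, ← mul_assoc, h2, one_mul]
  rw [this, smul_smul, inv_mul_cancel₀ hc, one_smul]

lemma pow_comm' {A : Type*} [Ring A] [Algebra ℂ A] {k x : A} {c : ℂ}
    (h : k * x = c • (x * k)) (n : ℕ) : k * x ^ n = c ^ n • (x ^ n * k) := by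
  induction n with
  | zero => simp
  | succ n ih =>
    rw [pow_succ, ← mul_assoc, ih, smul_mul_assoc, mul_assoc, h, mul_smul_comm, smul_smul,
      ← mul_assoc, ← pow_succ]

lemma k_mono (q : ℂ) (hq0 : q ≠ 0) (r s : ℕ) (m : ℤ) :
    ugen q 2 * Umono q (r, s, m) = (q ^ r * q⁻¹ ^ s) • Umono q (r, s, m + 1) := by
  have h0 := pow_comm' (conj_comm hq0 (u_kk q) (u_kk2 q) (u_kek q)).1 r
  have h1 := pow_comm' (conj_comm (inv_ne_zero hq0) (u_kk q) (u_kk2 q) (u_kfk q)).1 s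
  simp only [Umono]
  rw [← mul_assoc, ← mul_assoc, h0, smul_mul_assoc, mul_assoc _ (ugen q 2), h1, mul_smul_comm,
    ← mul_assoc, smul_smul, smul_mul_assoc, mul_assoc _ (ugen q 2), k_kpow]

lemma k'_mono (q : ℂ) (hq0 : q ≠ 0) (r s : ℕ) (m : ℤ) :
    ugen q 3 * Umono q (r, s, m) = (q⁻¹ ^ r * q⁻¹⁻¹ ^ s) • Umono q (r, s, m - 1) := by
  have h0 := pow_comm' (conj_comm hq0 (u_kk q) (u_kk2 q) (u_kek q)).2 r
  have h1 := pow_comm' (conj_comm (inv_ne_zero hq0) (u_kk q) (u_kk2 q) (u_kfk q)).2 s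
  simp only [Umono]
  rw [← mul_assoc, ← mul_assoc, h0, smul_mul_assoc, mul_assoc _ (ugen q 3), h1, mul_smul_comm,
    ← mul_assoc, smul_smul, smul_mul_assoc, mul_assoc _ (ugen q 3), k'_kpow]

lemma e_mono (q : ℂ) (r s : ℕ) (m : ℤ) :
    ugen q 0 * Umono q (r, s, m) = Umono q (r + 1, s, m) := by
  simp only [Umono, pow_succ', mul_assoc]

/-- The span of the monomials. -/
def Uspan (q : ℂ) : Submodule ℂ (QuantumU q) := Submodule.span ℂ (Set.range (Umono q))

lemma mono_mem (q : ℂ) (p : ℕ × ℕ × ℤ) : Umono q p ∈ Uspan q :=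
  Submodule.subset_span ⟨p, rfl⟩

lemma lmul_mem (q : ℂ) (a : QuantumU q) (h : ∀ p, a * Umono q p ∈ Uspan q)
    (x : QuantumU q) (hx : x ∈ Uspan q) : a * x ∈ Uspan q := by
  have : Uspan q ≤ (Uspan q).comap (LinearMap.mulLeft ℂ a) := by
    refine Submodule.span_le.2 ?_
    rintro _ ⟨p, rfl⟩
    exact h p
  exact this hx

lemma f_mono_mem (q : ℂ) (hq0 : q ≠ 0) (r s : ℕ) (m : ℤ) :
    ugen q 1 * Umono q (r, s, m) ∈ Uspan q := by
  induction r with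
  | zero =>
    have : ugen q 1 * Umono q (0, s, m) = Umono q (0, s + 1, m) := by
      simp only [Umono, pow_succ', pow_zero, one_mul, mul_assoc]
    rw [this]; exact mono_mem q _
  | succ r ih =>
    have h : ugen q 1 * ugen q 0
        = (q - q⁻¹)⁻¹ • (ugen q 2 - ugen q 3) - ugen q 0 * ugen q 1 := by
      rw [← u_ef]; abel
    rw [← e_mono, ← mul_assoc, h, sub_mul, smul_mul_assoc, sub_mul, k_mono q hq0,
      k'_mono q hq0, mul_assoc]
    refine Submodule.sub_mem _ (Submodule.smul_mem _ _ (Submodule.sub_mem _ ?_ ?_)) ?_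
    · exact Submodule.smul_mem _ _ (mono_mem q _)
    · exact Submodule.smul_mem _ _ (mono_mem q _)
    · refine lmul_mem q _ (fun p => ?_) _ ih
      obtain ⟨a, b, c⟩ := p
      rw [e_mono]; exact mono_mem q _

lemma gen_mem (q : ℂ) (hq0 : q ≠ 0) (i : Fin 4) (p : ℕ × ℕ × ℤ) :
    ugen q i * Umono q p ∈ Uspan q := by
  obtain ⟨r, s, m⟩ := p
  fin_cases i
  · change ugen q 0 * _ ∈ _
    rw [e_mono]; exact mono_mem q _
  · exact f_mono_mem q hq0 r s m
  · change ugen q 2 * _ ∈ _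
    rw [k_mono q hq0]; exact Submodule.smul_mem _ _ (mono_mem q _)
  · change ugen q 3 * _ ∈ _
    rw [k'_mono q hq0]; exact Submodule.smul_mem _ _ (mono_mem q _)

lemma all_mem (q : ℂ) (hq0 : q ≠ 0) (a : FreeAlgebra ℂ (Fin 4)) :
    ∀ x ∈ Uspan q, RingQuot.mkAlgHom ℂ (URel q) a * x ∈ Uspan q := by
  induction a using FreeAlgebra.induction with
  | grade0 c =>
    intro x hx
    rw [AlgHom.commutes, ← Algebra.smul_def]
    exact Submodule.smul_mem _ _ hx
  | grade1 i => exact lmul_mem q _ (gen_mem q hq0 i)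
  | mul a b ha hb =>
    intro x hx
    rw [map_mul, mul_assoc]
    exact ha _ (hb _ hx)
  | add a b ha hb =>
    intro x hx
    rw [map_add, add_mul]
    exact Submodule.add_mem _ (ha _ hx) (hb _ hx)

lemma Uspan_top (q : ℂ) (hq0 : q ≠ 0) : Uspan q = ⊤ := by
  rw [eq_top_iff]
  rintro x -
  obtain ⟨a, rfl⟩ := RingQuot.mkAlgHom_surjective ℂ (URel q) x
  have h1 : (1 : QuantumU q) ∈ Uspan q := by
    have : Umono q (0, 0, 0) = 1 := by simp [Umono, kpow]
    rw [← this]; exact mono_mem q _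
  simpa using all_mem q hq0 a 1 h1

/-- The model space. -/
abbrev VV := (ℕ × ℕ × ℤ) →₀ ℂ

/-- Basis vectors. -/
def bv (r s : ℕ) (m : ℤ) : VV := Finsupp.single (r, s, m) 1

/-- Operator from its values on basis vectors. -/
def mkOp (g : ℕ → ℕ → ℤ → VV) : Module.End ℂ VV :=
  Finsupp.linearCombination ℂ (fun p : ℕ × ℕ × ℤ => g p.1 p.2.1 p.2.2)

lemma mkOp_bv (g : ℕ → ℕ → ℤ → VV) (r s : ℕ) (m : ℤ) : mkOp g (bv r s m) = g r s m := by
  simp [mkOp, bv]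

lemma op_ext {S T : Module.End ℂ VV} (h : ∀ r s m, S (bv r s m) = T (bv r s m)) : S = T := by
  apply Finsupp.lhom_ext'
  rintro ⟨r, s, m⟩
  apply LinearMap.ext_ring
  exact h r s m

/-- Structure coefficients: `x` is `q` or `q⁻¹`. -/
def cf (x c : ℂ) : ℕ → ℂ
  | 0 => 0
  | r + 1 => x ^ r * c - cf x c r

/-- The four operators. -/
def opE : Module.End ℂ VV := mkOp fun r s m => bv (r + 1) s m
/-- The operator `F`. -/
def opF (q : ℂ) : Module.End ℂ VV := mkOp fun r s m =>
  (-1 : ℂ) ^ r • bv r (s + 1) m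
    + (cf q (q - q⁻¹)⁻¹ r * q⁻¹ ^ s) • bv (r - 1) s (m + 1)
    - (cf q⁻¹ (q - q⁻¹)⁻¹ r * q ^ s) • bv (r - 1) s (m - 1)
/-- The operator `K`. -/
def opK (q : ℂ) : Module.End ℂ VV := mkOp fun r s m => (q ^ r * q⁻¹ ^ s) • bv r s (m + 1)
/-- The operator `K'`. -/
def opK' (q : ℂ) : Module.End ℂ VV := mkOp fun r s m => (q⁻¹ ^ r * q ^ s) • bv r s (m - 1)

lemma opE_bv (r s : ℕ) (m : ℤ) : opE (bv r s m) = bv (r + 1) s m := mkOp_bv _ _ _ _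
lemma opF_bv (q : ℂ) (r s : ℕ) (m : ℤ) : opF q (bv r s m) = (-1 : ℂ) ^ r • bv r (s + 1) m
    + (cf q (q - q⁻¹)⁻¹ r * q⁻¹ ^ s) • bv (r - 1) s (m + 1)
    - (cf q⁻¹ (q - q⁻¹)⁻¹ r * q ^ s) • bv (r - 1) s (m - 1) := mkOp_bv _ _ _ _
lemma opK_bv (q : ℂ) (r s : ℕ) (m : ℤ) :
    opK q (bv r s m) = (q ^ r * q⁻¹ ^ s) • bv r s (m + 1) := mkOp_bv _ _ _ _
lemma opK'_bv (q : ℂ) (r s : ℕ) (m : ℤ) :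
    opK' q (bv r s m) = (q⁻¹ ^ r * q ^ s) • bv r s (m - 1) := mkOp_bv _ _ _ _

lemma op_kk (q : ℂ) (hq0 : q ≠ 0) : opK q * opK' q = 1 := by
  refine op_ext fun r s m => ?_
  simp only [Module.End.mul_apply, Module.End.one_apply, opK_bv, opK'_bv, map_smul, smul_smul,
    sub_add_cancel]
  convert one_smul ℂ _
  simp only [inv_pow]
  field_simp

lemma op_kk2 (q : ℂ) (hq0 : q ≠ 0) : opK' q * opK q = 1 := by
  refine op_ext fun r s m => ?_
  simp only [Module.End.mul_apply, Module.End.one_apply, opK_bv, opK'_bv, map_smul, smul_smul,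
    add_sub_cancel_right]
  convert one_smul ℂ _
  simp only [inv_pow]
  field_simp

lemma op_kek (q : ℂ) (hq0 : q ≠ 0) : opK q * opE * opK' q = q • opE := by
  refine op_ext fun r s m => ?_
  simp only [Module.End.mul_apply, LinearMap.smul_apply, opK_bv, opK'_bv, opE_bv, map_smul,
    smul_smul, sub_add_cancel]
  congr 1
  simp only [inv_pow]
  field_simp
  ring

lemma op_kfk (q : ℂ) (hq0 : q ≠ 0) : opK q * opF q * opK' q = q⁻¹ • opF q := by
  refine op_ext fun r s m => ?_
  simp only [Module.End.mul_apply, LinearMap.smul_apply, opK_bv, opK'_bv, opF_bv, map_smul,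
    map_add, map_sub, smul_smul, sub_add_cancel, smul_add, smul_sub, add_sub_cancel_right]
  cases r with
  | zero =>
    simp only [cf, zero_mul, mul_zero, zero_smul, add_zero, sub_zero]
    congr 1
    simp only [inv_pow]
    field_simp
    ring
  | succ r =>
    simp only [Nat.add_sub_cancel]
    generalize cf q (q - q⁻¹)⁻¹ (r + 1) = A
    generalize cf q⁻¹ (q - q⁻¹)⁻¹ (r + 1) = B
    congr 1
    · congr 1
      · congr 1
        simp only [inv_pow]
        field_simp
        ring
      · congr 1
        simp only [inv_pow]
        field_simp
        ring
    · congr 1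
      simp only [inv_pow]
      field_simp
      ring

lemma op_ef (q : ℂ) : opE * opF q + opF q * opE = (q - q⁻¹)⁻¹ • (opK q - opK' q) := by
  refine op_ext fun r s m => ?_
  simp only [Module.End.mul_apply, LinearMap.smul_apply, LinearMap.add_apply,
    LinearMap.sub_apply, opK_bv, opK'_bv, opE_bv, opF_bv, map_smul,
    map_add, map_sub, smul_smul, smul_sub, Nat.add_sub_cancel]
  cases r with
  | zero =>
    simp only [cf, zero_mul, zero_smul, add_zero, sub_zero]
    module
  | succ r =>
    simp only [cf, Nat.add_sub_cancel]
    module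

/-- Images of generators. -/
def opGen (q : ℂ) : Fin 4 → Module.End ℂ VV := ![opE, opF q, opK q, opK' q]

/-- The representation. -/
def repU (q : ℂ) (hq0 : q ≠ 0) : QuantumU q →ₐ[ℂ] Module.End ℂ VV :=
  RingQuot.liftAlgHom ℂ ⟨FreeAlgebra.lift ℂ (opGen q), by
    intro x y h
    cases h with
    | kk' => simpa [Ugen, opGen] using op_kk q hq0
    | k'k => simpa [Ugen, opGen] using op_kk2 q hq0
    | kek' => simpa [Ugen, opGen] using op_kek q hq0
    | kfk' => simpa [Ugen, opGen] using op_kfk q hq0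
    | ef => simpa [Ugen, opGen] using op_ef q⟩

lemma repU_gen (q : ℂ) (hq0 : q ≠ 0) (i : Fin 4) : repU q hq0 (ugen q i) = opGen q i := by
  simp [repU, ugen, Ugen]

lemma repU_mono (q : ℂ) (hq0 : q ≠ 0) (r s : ℕ) (m : ℤ) :
    repU q hq0 (Umono q (r, s, m)) (bv 0 0 0) = bv r s m := by
  have hE : ∀ r, (opE ^ r) (bv 0 s m) = bv r s m := by
    intro r
    induction r with
    | zero => simp
    | succ r ih => rw [pow_succ', Module.End.mul_apply, ih, opE_bv]
  have hF : ∀ s, (opF q ^ s) (bv 0 0 m) = bv 0 s m := by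
    intro s
    induction s with
    | zero => simp
    | succ s ih => rw [pow_succ', Module.End.mul_apply, ih, opF_bv]; simp [cf]
  have hK : ∀ n : ℕ, (opK q ^ n) (bv 0 0 0) = bv 0 0 n := by
    intro n
    induction n with
    | zero => simp
    | succ n ih => rw [pow_succ', Module.End.mul_apply, ih, opK_bv]; simp
  have hK' : ∀ n : ℕ, (opK' q ^ n) (bv 0 0 0) = bv 0 0 (-n) := by
    intro n
    induction n with
    | zero => simp
    | succ n ih =>
      rw [pow_succ', Module.End.mul_apply, ih, opK'_bv]
      simp only [pow_zero, mul_one, one_smul]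
      congr 1
      push_cast
      ring
  have hk : repU q hq0 (kpow q m) (bv 0 0 0) = bv 0 0 m := by
    unfold kpow
    split_ifs with h
    · rw [map_pow, repU_gen]
      refine (hK _).trans ?_
      rw [Int.toNat_of_nonneg h]
    · rw [map_pow, repU_gen]
      refine (hK' _).trans ?_
      rw [Int.toNat_of_nonneg (by omega), neg_neg]
  simp only [Umono, map_mul, map_pow, Module.End.mul_apply, hk, repU_gen]
  change (opE ^ r) ((opF q ^ s) (bv 0 0 m)) = _
  rw [hF, hE]

/-- PBW basis: the monomials `e^r f^s k^m`, `r, s ∈ ℕ`, `m ∈ ℤ`,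
form a ℂ-basis of `𝒰 = U_q(osp(1,2))`. -/
theorem quantumU_basis (q : ℂ) (hq0 : q ≠ 0) (hq : ∀ n : ℕ, 0 < n → q ^ n ≠ 1) :
    LinearIndependent ℂ (Umono q) ∧
      Submodule.span ℂ (Set.range (Umono q)) = ⊤ := by
  refine ⟨?_, Uspan_top q hq0⟩
  let ev : QuantumU q →ₗ[ℂ] VV :=
    (LinearMap.applyₗ (R := ℂ) (bv 0 0 0)).comp (repU q hq0).toLinearMap
  refine LinearIndependent.of_comp ev ?_
  have : (ev ∘ Umono q) = fun p => Finsupp.single p (1 : ℂ) := by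
    funext p
    obtain ⟨r, s, m⟩ := p
    exact repU_mono q hq0 r s m
  rw [this]
  exact Finsupp.linearIndependent_single_one ℂ _

end
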